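/- arXiv:2605.03655 — 4 statements merged into one kernel-verified Lean document; each statement's English description precedes it below -/
import Mathlib

section
/- Let 0 < p < 1 and let i be a nonnegative integer. Then there is a constant C > 0 such that for every finite family of real numbers x₁, …, x_m with ∑_{j=1}^m |x_j|^p ≤ 1, one has ∑_{j=1}^m |x_j|·|log|x_j||^i ≤ C (in particular |∑_{j=1}^m x_j·(log|x_j|)^i| ≤ C). -/
/-- On `[0, 1]`, the function `y * |log y| ^ i` is dominated by a multiple of `y ^ p`
whenever `p < 1`. -/
theorem Real.mul_abs_log_pow_le_mul_rpow {p : ℝ} (hp0 : 0 < p) (hp1 : p < 1) (i : ℕ)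
    {y : ℝ} (hy0 : 0 ≤ y) (hy1 : y ≤ 1) :
    y * |Real.log y| ^ i ≤ (1 / ((1 - p) / (i + 1))) ^ i * y ^ p := by
  obtain rfl | hy := hy0.eq_or_lt
  · simp [Real.zero_rpow hp0.ne']
  set t : ℝ := (1 - p) / (i + 1) with ht
  have ht0 : 0 < t := div_pos (by linarith) (by positivity)
  have hlog : |Real.log y| * y ^ t ≤ 1 / t := by
    have h := (Real.abs_log_mul_self_rpow_lt y t hy hy1 ht0).le
    rwa [abs_mul, abs_of_pos (Real.rpow_pos_of_pos hy t)] at h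
  have hsplit : y = y ^ p * y ^ t * (y ^ t) ^ i := by
    rw [← Real.rpow_mul_natCast hy.le, ← Real.rpow_add hy, ← Real.rpow_add hy]
    have hexp : p + t + t * i = 1 := by
      rw [ht]
      field_simp
      ring
    rw [hexp, Real.rpow_one]
  calc y * |Real.log y| ^ i
      = (y ^ p * y ^ t * (y ^ t) ^ i) * |Real.log y| ^ i := by rw [← hsplit]
    _ = (|Real.log y| * y ^ t) ^ i * (y ^ p * y ^ t) := by ring
    _ ≤ (1 / t) ^ i * (y ^ p * 1) := by
        gcongr
        exact Real.rpow_le_one hy.le hy1 ht0.le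
    _ = (1 / t) ^ i * y ^ p := by rw [mul_one]

/-- For `0 < p < 1` and a nonnegative integer `i`, there is a constant `C > 0` such
that any finite family of reals `x₁, …, x_m` with `∑ |x_j|^p ≤ 1` satisfies
`∑ |x_j|·|log|x_j||^i ≤ C`, and in particular `|∑ x_j·(log|x_j|)^i| ≤ C`. -/
theorem sum_mul_pow_log_bounded_of_rpow_sum_le_one (p : ℝ) (hp0 : 0 < p) (hp1 : p < 1)
    (i : ℕ) :
    ∃ C : ℝ, 0 < C ∧ ∀ (m : ℕ) (x : Fin m → ℝ),
      (∑ j, |x j| ^ p) ≤ 1 →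
      (∑ j, |x j| * (abs (Real.log |x j|)) ^ i) ≤ C ∧
      abs (∑ j, x j * (Real.log |x j|) ^ i) ≤ C := by
  have hp : 0 < 1 - p := sub_pos.mpr hp1
  refine ⟨(1 / ((1 - p) / (i + 1))) ^ i, by positivity, fun m x hx => ?_⟩
  have hle (j : Fin m) : |x j| ≤ 1 := by
    by_contra! h
    refine (Real.one_lt_rpow h hp0).not_ge ?_
    exact (Finset.single_le_sum (fun k _ => Real.rpow_nonneg (abs_nonneg (x k)) p)
      (Finset.mem_univ j)).trans hx
  have hsum : ∑ j, |x j| * abs (Real.log |x j|) ^ i ≤ (1 / ((1 - p) / (i + 1))) ^ i := by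
    calc ∑ j, |x j| * abs (Real.log |x j|) ^ i
        ≤ ∑ j, (1 / ((1 - p) / (i + 1))) ^ i * |x j| ^ p :=
          Finset.sum_le_sum fun j _ =>
            Real.mul_abs_log_pow_le_mul_rpow hp0 hp1 i (abs_nonneg _) (hle j)
      _ = (1 / ((1 - p) / (i + 1))) ^ i * ∑ j, |x j| ^ p := by rw [Finset.mul_sum]
      _ ≤ (1 / ((1 - p) / (i + 1))) ^ i := mul_le_of_le_one_right (by positivity) hx
  refine ⟨hsum, (Finset.abs_sum_le_sum_abs _ _).trans ?_⟩
  simpa only [abs_mul, abs_pow] using hsum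
end

section
/- Let λ : ℕ × ℕ → ℝ be a function with 0 < λ(n,m) ≤ 1 for all n, m, which is a null family in the sense that λ tends to 0 along the cofinite filter on ℕ × ℕ (for every ε > 0, λ(n,m) ≥ ε for only finitely many pairs (n,m)). Then there exist sequences μ, ν : ℕ → ℝ with 0 < μ(n) ≤ 1 and 0 < ν(m) ≤ 1 for all n, m, both tending to 0 at infinity, such that λ(n,m) ≤ μ(n)·ν(m) for all n, m. -/
open Filter

/-- If a nonnegative function tends to `0` along the cofinite filter, then its suprema over the
sets where a given height function is at least `n` tend to `0` as `n` grows. -/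
theorem tendsto_sSup_image_tail {α : Type*} {f : α → ℝ} (h : α → ℕ) (hf_nonneg : ∀ a, 0 ≤ f a)
    (hf : Tendsto f cofinite (nhds 0)) :
    Tendsto (fun n => sSup (f '' {a | n ≤ h a})) atTop (nhds 0) := by
  rw [Metric.tendsto_atTop]
  intro ε hε
  have hfin : {a | ¬ f a < ε / 2}.Finite :=
    hf.eventually_lt_const (half_pos hε)
  obtain ⟨N, hN⟩ := (hfin.image h).bddAbove
  refine ⟨N + 1, fun n hn => ?_⟩
  have h_nonneg : 0 ≤ sSup (f '' {a | n ≤ h a}) :=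
    Real.sSup_nonneg (by rintro _ ⟨a, -, rfl⟩; exact hf_nonneg a)
  have h_le : sSup (f '' {a | n ≤ h a}) ≤ ε / 2 := by
    refine Real.sSup_le ?_ (half_pos hε).le
    rintro _ ⟨a, ha, rfl⟩
    by_contra! hlt
    have := hN ⟨a, not_lt.mpr hlt.le, rfl⟩
    have : n ≤ h a := ha
    omega
  rw [Real.dist_eq, sub_zero, abs_of_nonneg h_nonneg]
  linarith

/-- Any positive null family `λ : ℕ × ℕ → (0,1]` (tending to `0` along the cofinite
filter) is dominated by a product `μ(n)·ν(m)` of two positive null sequences with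
values in `(0,1]`. -/
theorem null_family_dominated_by_product (l : ℕ × ℕ → ℝ)
    (hl_pos : ∀ n m : ℕ, 0 < l (n, m)) (hl_le : ∀ n m : ℕ, l (n, m) ≤ 1)
    (hl_null : Tendsto l cofinite (nhds 0)) :
    ∃ μ ν : ℕ → ℝ,
      (∀ n, 0 < μ n) ∧ (∀ n, μ n ≤ 1) ∧
      (∀ m, 0 < ν m) ∧ (∀ m, ν m ≤ 1) ∧
      Tendsto μ atTop (nhds 0) ∧ Tendsto ν atTop (nhds 0) ∧
      ∀ n m : ℕ, l (n, m) ≤ μ n * ν m := by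
  set s : ℕ → ℝ := fun n => sSup (l '' {p | n ≤ max p.1 p.2})
  have le_s (k n m : ℕ) (hk : k ≤ max n m) : l (n, m) ≤ s k :=
    le_csSup ⟨1, by rintro _ ⟨p, -, rfl⟩; exact hl_le p.1 p.2⟩ ⟨(n, m), hk, rfl⟩
  have s_pos (n : ℕ) : 0 < s n := (hl_pos n n).trans_le (le_s n n n (le_max_left n n))
  have s_le (n : ℕ) : s n ≤ 1 :=
    Real.sSup_le (by rintro _ ⟨p, -, rfl⟩; exact hl_le p.1 p.2) zero_le_one
  have sqrt_pos (n : ℕ) : 0 < √(s n) := Real.sqrt_pos.mpr (s_pos n)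
  have sqrt_le (n : ℕ) : √(s n) ≤ 1 := Real.sqrt_le_one.mpr (s_le n)
  have sqrt_tendsto : Tendsto (fun n => √(s n)) atTop (nhds 0) := by
    simpa only [Real.sqrt_zero] using (tendsto_sSup_image_tail (fun p : ℕ × ℕ => max p.1 p.2)
      (fun p => (hl_pos p.1 p.2).le) hl_null).sqrt
  refine ⟨fun n => √(s n), fun n => √(s n), sqrt_pos, sqrt_le, sqrt_pos, sqrt_le,
    sqrt_tendsto, sqrt_tendsto, fun n m => ?_⟩
  calc l (n, m) = √(l (n, m)) * √(l (n, m)) := (Real.mul_self_sqrt (hl_pos n m).le).symm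
    _ ≤ √(s n) * √(s m) := by
      gcongr
      · exact le_s n n m (le_max_left n m)
      · exact le_s m n m (le_max_right n m)
end

section
/- Let X be a topological space which is the union of an increasing sequence of subsets X₀ ⊆ X₁ ⊆ ⋯ such that each Xₙ is compact and Hausdorff in the subspace topology, and such that X carries the colimit topology: a set U ⊆ X is open if and only if U ∩ Xₙ is open in Xₙ for all n. Let Y with subsets Y₀ ⊆ Y₁ ⊆ ⋯ satisfy the same hypotheses. Then the product topology on X × Y coincides with the colimit topology from the Xₙ × Yₙ: a subset U ⊆ X × Y is open in the product topology if and only if U ∩ (Xₙ × Yₙ) is open in the subspace (and product) topology of Xₙ × Yₙ for every n. -/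
open Set Topology

/-- A tube lemma with compact neighbourhoods in locally compact spaces. -/
theorem exists_compact_prod_between {S T : Type*} [TopologicalSpace S] [TopologicalSpace T]
    [LocallyCompactSpace S] [LocallyCompactSpace T] {K : Set S} {L : Set T} {U : Set (S × T)}
    (hK : IsCompact K) (hL : IsCompact L) (hU : IsOpen U) (hKL : K ×ˢ L ⊆ U) :
    ∃ K' L', IsCompact K' ∧ IsCompact L' ∧ K ⊆ interior K' ∧ L ⊆ interior L' ∧
      K' ×ˢ L' ⊆ U := by
  obtain ⟨V, W, hV, hW, hKV, hLW, hVW⟩ := generalized_tube_lemma hK hL hU hKL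
  obtain ⟨K', hK', hKK', hK'V⟩ := exists_compact_between hK hV hKV
  obtain ⟨L', hL', hLL', hL'W⟩ := exists_compact_between hL hW hLW
  exact ⟨K', L', hK', hL', hKK', hLL', (prod_mono hK'V hL'W).trans hVW⟩

theorem image_val_mem_nhdsWithin {X : Type*} [TopologicalSpace X] {P K : Set X} {A : Set P}
    (hKP : K ⊆ P) (h : Subtype.val ⁻¹' K ⊆ interior A) {a : X} (ha : a ∈ K) :
    Subtype.val '' A ∈ 𝓝[P] a := by
  rw [← preimage_coe_mem_nhds_subtype (a := ⟨a, hKP ha⟩),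
    preimage_image_eq _ Subtype.val_injective]
  exact mem_interior_iff_mem_nhds.mp (h ha)

/-- Relative version of `exists_compact_prod_between` for compact Hausdorff subspaces. -/
theorem exists_compact_prod_nhdsWithin {X Y : Type*} [TopologicalSpace X] [TopologicalSpace Y]
    {P : Set X} {Q : Set Y} [T2Space P] [T2Space Q] (hP : IsCompact P) (hQ : IsCompact Q)
    {U : Set (X × Y)} (hU : IsOpen ((fun p : P × Q => ((p.1 : X), (p.2 : Y))) ⁻¹' U))
    {K : Set X} {L : Set Y} (hK : IsCompact K) (hL : IsCompact L) (hKP : K ⊆ P) (hLQ : L ⊆ Q)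
    (hKL : K ×ˢ L ⊆ U) :
    ∃ K' L', (IsCompact K' ∧ IsCompact L' ∧ K' ⊆ P ∧ L' ⊆ Q ∧ K' ×ˢ L' ⊆ U) ∧
      (∀ a ∈ K, K' ∈ 𝓝[P] a) ∧ ∀ b ∈ L, L' ∈ 𝓝[Q] b := by
  have := isCompact_iff_compactSpace.mp hP
  have := isCompact_iff_compactSpace.mp hQ
  have hK₀ : IsCompact (Subtype.val ⁻¹' K : Set P) :=
    IsInducing.subtypeVal.isCompact_preimage' hK (by simpa using hKP)
  have hL₀ : IsCompact (Subtype.val ⁻¹' L : Set Q) :=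
    IsInducing.subtypeVal.isCompact_preimage' hL (by simpa using hLQ)
  obtain ⟨A, B, hA, hB, hKA, hLB, hAB⟩ :=
    exists_compact_prod_between hK₀ hL₀ hU fun p hp => hKL ⟨hp.1, hp.2⟩
  refine ⟨Subtype.val '' A, Subtype.val '' B,
    ⟨hA.image continuous_subtype_val, hB.image continuous_subtype_val,
      Subtype.coe_image_subset _ _, Subtype.coe_image_subset _ _, ?_⟩,
    fun a ha => image_val_mem_nhdsWithin hKP hKA ha,
    fun b hb => image_val_mem_nhdsWithin hLQ hLB hb⟩
  rintro ⟨_, _⟩ ⟨⟨a, ha, rfl⟩, ⟨b, hb, rfl⟩⟩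
  exact hAB (mk_mem_prod ha hb)

theorem monotone_of_mem_nhdsWithin {X : Type*} [TopologicalSpace X] {Xs A : ℕ → Set X}
    (hXs : Monotone Xs) (hA : ∀ n, A n ⊆ Xs n)
    (hnhds : ∀ n, ∀ a ∈ A n, A (n + 1) ∈ 𝓝[Xs (n + 1)] a) : Monotone A :=
  monotone_nat_of_le_succ fun n a ha =>
    mem_of_mem_nhdsWithin (hXs n.le_succ (hA n ha)) (hnhds n a ha)

theorem isOpen_preimage_val_iUnion {X : Type*} [TopologicalSpace X] {Xs A : ℕ → Set X}
    (hXs : Monotone Xs) (hA : ∀ n, A n ⊆ Xs n)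
    (hnhds : ∀ n, ∀ a ∈ A n, A (n + 1) ∈ 𝓝[Xs (n + 1)] a) (k : ℕ) :
    IsOpen (Subtype.val ⁻¹' (⋃ n, A n) : Set (Xs k)) := by
  refine isOpen_iff_mem_nhds.mpr fun z hz => preimage_coe_mem_nhds_subtype.mpr ?_
  obtain ⟨n, hn⟩ := mem_iUnion.mp hz
  have hz' := monotone_of_mem_nhdsWithin hXs hA hnhds (le_max_left n k) hn
  exact Filter.mem_of_superset
    (nhdsWithin_mono _ (hXs ((le_max_right n k).trans (Nat.le_succ _))) (hnhds _ _ hz'))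
    (subset_iUnion A _)

/-- If `X` (resp. `Y`) is an increasing union of compact Hausdorff subsets
`X₀ ⊆ X₁ ⊆ ⋯` (resp. `Y₀ ⊆ Y₁ ⊆ ⋯`) and carries the colimit topology, then the
product topology on `X × Y` coincides with the colimit topology from the
`Xₙ × Yₙ`: a set `U ⊆ X × Y` is open iff its intersection with each `Xₙ × Yₙ`
is open there. -/
theorem product_of_increasing_unions_is_colimit
    (X Y : Type*) [TopologicalSpace X] [TopologicalSpace Y]
    (Xs : ℕ → Set X) (Ys : ℕ → Set Y)
    (hXmono : Monotone Xs) (hYmono : Monotone Ys)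
    (hXcomp : ∀ n, IsCompact (Xs n)) (hYcomp : ∀ n, IsCompact (Ys n))
    (hXt2 : ∀ n, T2Space (Xs n)) (hYt2 : ∀ n, T2Space (Ys n))
    (hXunion : (⋃ n, Xs n) = Set.univ) (hYunion : (⋃ n, Ys n) = Set.univ)
    (hXcolim : ∀ U : Set X, IsOpen U ↔
      ∀ n, IsOpen ((Subtype.val ⁻¹' U : Set (Xs n))))
    (hYcolim : ∀ U : Set Y, IsOpen U ↔
      ∀ n, IsOpen ((Subtype.val ⁻¹' U : Set (Ys n)))) :
    ∀ U : Set (X × Y), IsOpen U ↔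
      ∀ n, IsOpen ((fun p : (Xs n) × (Ys n) => ((p.1 : X), (p.2 : Y))) ⁻¹' U) := by
  intro U
  refine ⟨fun hU n => hU.preimage (by fun_prop), fun hU => isOpen_prod_iff.mpr fun x y hxy => ?_⟩
  obtain ⟨i, hi⟩ := mem_iUnion.mp (hXunion.symm ▸ mem_univ x)
  obtain ⟨j, hj⟩ := mem_iUnion.mp (hYunion.symm ▸ mem_univ y)
  let m := max i j
  have hXm : Monotone fun n => Xs (m + n) := fun _ _ h => hXmono (by gcongr)
  have hYm : Monotone fun n => Ys (m + n) := fun _ _ h => hYmono (by gcongr)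
  let Good (n : ℕ) (p : Set X × Set Y) : Prop :=
    IsCompact p.1 ∧ IsCompact p.2 ∧ p.1 ⊆ Xs (m + n) ∧ p.2 ⊆ Ys (m + n) ∧ p.1 ×ˢ p.2 ⊆ U
  have step : ∀ (n : ℕ) (p : Set X × Set Y), Good n p → ∃ q, Good (n + 1) q ∧
      (∀ a ∈ p.1, q.1 ∈ 𝓝[Xs (m + (n + 1))] a) ∧ ∀ b ∈ p.2, q.2 ∈ 𝓝[Ys (m + (n + 1))] b := by
    rintro n p ⟨hK, hL, hKX, hLY, hKL⟩
    have := hXt2 (m + (n + 1))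
    have := hYt2 (m + (n + 1))
    obtain ⟨K', L', h⟩ := exists_compact_prod_nhdsWithin (hXcomp _) (hYcomp _) (hU _) hK hL
      (hKX.trans (hXm n.le_succ)) (hLY.trans (hYm n.le_succ)) hKL
    exact ⟨(K', L'), h⟩
  choose! next hGood hnextX hnextY using step
  let s : ℕ → Set X × Set Y := Nat.rec ({x}, {y}) next
  have hs (n : ℕ) : Good n (s n) := by
    induction n with
    | zero =>
      refine ⟨isCompact_singleton, isCompact_singleton, ?_, ?_, ?_⟩
      · exact singleton_subset_iff.mpr (hXmono (le_max_left i j) hi)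
      · exact singleton_subset_iff.mpr (hYmono (le_max_right i j) hj)
      · exact (singleton_prod_singleton (a := x) (b := y)).trans_subset
          (singleton_subset_iff.mpr hxy)
    | succ n ih => exact hGood n _ ih
  have hsX (n : ℕ) : (s n).1 ⊆ Xs (m + n) := (hs n).2.2.1
  have hsY (n : ℕ) : (s n).2 ⊆ Ys (m + n) := (hs n).2.2.2.1
  have hnX (n : ℕ) := hnextX n _ (hs n)
  have hnY (n : ℕ) := hnextY n _ (hs n)
  refine ⟨⋃ n, (s n).1, ⋃ n, (s n).2, (hXcolim _).mpr fun k => ?_, (hYcolim _).mpr fun k => ?_,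
    mem_iUnion.mpr ⟨0, rfl⟩, mem_iUnion.mpr ⟨0, rfl⟩, ?_⟩
  · exact (isOpen_preimage_val_iUnion hXm hsX hnX k).preimage
      (continuous_inclusion (hXmono (Nat.le_add_left k m)))
  · exact (isOpen_preimage_val_iUnion hYm hsY hnY k).preimage
      (continuous_inclusion (hYmono (Nat.le_add_left k m)))
  · rintro ⟨a, b⟩ ⟨ha, hb⟩
    obtain ⟨p, hp⟩ := mem_iUnion.mp ha
    obtain ⟨q, hq⟩ := mem_iUnion.mp hb
    exact (hs (max p q)).2.2.2.2
      ⟨monotone_of_mem_nhdsWithin hXm hsX hnX (le_max_left p q) hp,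
        monotone_of_mem_nhdsWithin hYm hsY hnY (le_max_right p q) hq⟩
end

section
/- Let S be a profinite topological space (compact, Hausdorff and totally disconnected), and let x be a nonzero element of the free abelian group on S. Then there exist a finite discrete topological space T and a continuous map π : S → T such that the image of x under the induced homomorphism of free abelian groups FreeAbelianGroup S → FreeAbelianGroup T is nonzero. -/
theorem FreeAbelianGroup.lift_eq_sum_toFinsupp {X G : Type*} [AddCommGroup G] (f : X → G)
    (x : FreeAbelianGroup X) :
    FreeAbelianGroup.lift f x = (FreeAbelianGroup.toFinsupp x).sum fun a n => n • f a := by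
  induction x using FreeAbelianGroup.induction_on with
  | zero => simp
  | of a => simp
  | neg a _ => simp [Finsupp.sum_neg_index]
  | add x y hx hy =>
    rw [map_add, map_add, hx, hy, Finsupp.sum_add_index'] <;> simp [add_smul]

/-- Let `S` be a profinite space (compact, Hausdorff, totally disconnected) and let
`x` be a nonzero element of the free abelian group on `S`. Then there is a finite
discrete space `T` and a continuous map `π : S → T` such that the image of `x` in
the free abelian group on `T` is nonzero. -/
theorem freeAbelianGroup_to_finite_quotient_nonzero
    (S : Type*) [TopologicalSpace S] [CompactSpace S] [T2Space S]
    [TotallyDisconnectedSpace S] (x : FreeAbelianGroup S) (hx : x ≠ 0) :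
    ∃ (T : Type) (_ : Fintype T) (_ : TopologicalSpace T),
      DiscreteTopology T ∧
      ∃ π : S → T, Continuous π ∧ FreeAbelianGroup.map π x ≠ 0 := by
  classical
  set c := FreeAbelianGroup.toFinsupp x with hc
  have hc0 : c ≠ 0 := fun h => hx <| by
    rw [← Finsupp.toFreeAbelianGroup_toFinsupp x, ← hc, h, map_zero]
  obtain ⟨s, hs⟩ := Finsupp.support_nonempty_iff.mpr hc0
  obtain ⟨U, hU, hsU, hUc⟩ := compact_exists_isClopen_in_isOpen
    (c.support.erase s).finite_toSet.isClosed.isOpen_compl (x := s) (by simp)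
  refine ⟨Bool, inferInstance, inferInstance, inferInstance, U.boolIndicator,
    (continuous_boolIndicator_iff_isClopen U).mpr hU, fun h => Finsupp.mem_support_iff.mp hs ?_⟩
  have key := congrArg (FreeAbelianGroup.lift fun b : Bool => if b then (1 : ℤ) else 0) h
  rw [map_zero, ← FreeAbelianGroup.lift_comp, FreeAbelianGroup.lift_eq_sum_toFinsupp, ← hc,
    Finsupp.sum, Finset.sum_eq_single_of_mem s hs] at key
  · simpa [(Set.mem_iff_boolIndicator U s).mp hsU] using key
  · intro t ht hts
    have htU : t ∉ U := fun h' => hUc h' (Finset.mem_coe.mpr (Finset.mem_erase.mpr ⟨hts, ht⟩))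
    simp [(Set.notMem_iff_boolIndicator U t).mp htU]
end
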